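/- The square of the inverse hyperbolic cosine is smooth up to the boundary point 1: the function t ↦ (arcosh t)² is infinitely differentiable within the set [1, ∞) at every point of [1, ∞); equivalently, there exists a smooth function F : ℝ → ℝ with F(cosh s) = s² for all real s, and F(t) = (arcosh t)² for all t ≥ 1. -/

import Mathlib

/-- The inverse hyperbolic cosine, `arcosh t = log (t + √(t² - 1))`. -/
noncomputable def arcosh (t : ℝ) : ℝ := Real.log (t + Real.sqrt (t ^ 2 - 1))

open Filter Topology Set Metric
open scoped ContDiff Nat

/-- A function that is smooth on `(a, ∞)` and agrees to the right of `a` with a function smooth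
near `a` is the restriction to `[a, ∞)` of a smooth function on the line. -/
theorem exists_contDiff_eqOn_Ici {f g : ℝ → ℝ} {a : ℝ}
    (hf : ∀ x, a < x → ContDiffAt ℝ ∞ f x) (hg : ∀ᶠ x in 𝓝 a, ContDiffAt ℝ ∞ g x)
    (hgf : ∀ᶠ x in 𝓝[≥] a, g x = f x) :
    ∃ F : ℝ → ℝ, ContDiff ℝ ∞ F ∧ EqOn F f (Ici a) := by
  obtain ⟨r, hr, hball⟩ := Metric.eventually_nhds_iff_ball.1 hg
  let χ : ContDiffBump a := ⟨r / 4, r / 2, by positivity, by linarith⟩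
  have hχg : ContDiff ℝ ∞ fun x => χ x * g x := by
    rw [contDiff_iff_contDiffAt]
    intro x
    by_cases hx : x ∈ ball a r
    · exact χ.contDiff.contDiffAt.mul (hball x hx)
    · have hx' : x ∉ tsupport χ := by
        rw [χ.tsupport_eq]
        intro h
        exact hx (closedBall_subset_ball (by change r / 2 < r; linarith) h)
      refine (contDiffAt_const (c := (0 : ℝ))).congr_of_eventuallyEq ?_
      filter_upwards [notMem_tsupport_iff_eventuallyEq.1 hx'] with y hy
      simp [hy]
  refine ⟨fun x => if a ≤ x then f x else χ x * g x, ?_, fun x hx => if_pos hx⟩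
  rw [contDiff_iff_contDiffAt]
  intro x
  rcases lt_trichotomy x a with hx | rfl | hx
  · refine hχg.contDiffAt.congr_of_eventuallyEq ?_
    filter_upwards [Iio_mem_nhds hx] with y hy
    exact if_neg (not_le.2 hy)
  · refine hχg.contDiffAt.congr_of_eventuallyEq ?_
    filter_upwards [χ.eventuallyEq_one, eventually_nhdsWithin_iff.1 hgf] with y hy hy'
    split_ifs with h
    · simp [hy, hy' h]
    · rfl
  · refine (hf x hx).congr_of_eventuallyEq ?_
    filter_upwards [Ioi_mem_nhds hx] with y hy
    exact if_pos (le_of_lt hy)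

/-- The hyperbolic cosine is an analytic function of the square of its argument, with
nonzero derivative at the origin. -/
theorem exists_analyticAt_sq_eq_cosh :
    ∃ g : ℝ → ℝ, AnalyticAt ℝ g 0 ∧ HasDerivAt g (1 / 2) 0 ∧ ∀ s, g (s ^ 2) = Real.cosh s := by
  let c : ℕ → ℝ := fun n => ((2 * n)! : ℝ)⁻¹
  have hc : (FormalMultilinearSeries.ofScalars ℝ c).radius = ⊤ := by
    refine FormalMultilinearSeries.ofScalars_radius_eq_top_of_tendsto ℝ c
      (Eventually.of_forall fun n => by positivity) ?_
    refine squeeze_zero (fun n => by positivity) (fun n => ?_)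
      tendsto_one_div_add_atTop_nhds_zero_nat
    have h : ((2 * n.succ)! : ℝ) = (2 * n + 2) * ((2 * n + 1) * (2 * n)!) := by
      rw [show 2 * n.succ = 2 * n + 1 + 1 by lia, Nat.factorial_succ, Nat.factorial_succ]
      push_cast
      ring
    have h0 : (0 : ℝ) < (2 * n)! := by positivity
    simp only [c, norm_inv, Real.norm_natCast]
    rw [inv_div_inv, h, div_le_div_iff₀ (by positivity) (by positivity)]
    nlinarith [mul_nonneg h0.le (Nat.cast_nonneg (α := ℝ) n),
      mul_nonneg h0.le (sq_nonneg (n : ℝ))]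
  have hps := ((FormalMultilinearSeries.ofScalars ℝ c).hasFPowerSeriesOnBall
    (by simp [hc])).hasFPowerSeriesAt
  refine ⟨FormalMultilinearSeries.ofScalarsSum c, hps.analyticAt, ?_, fun s => ?_⟩
  · convert! hps.hasDerivAt using 1
    simp [c]
  · rw [FormalMultilinearSeries.ofScalars_sum_eq, Real.cosh_eq_tsum]
    refine tsum_congr fun n => ?_
    simp only [c, smul_eq_mul, pow_mul]
    ring

/-- Near `1`, the square of `arcosh` is the restriction of an analytic function. -/
theorem exists_contDiffAt_eventuallyEq_arcosh_sq :
    ∃ g : ℝ → ℝ, ContDiffAt ℝ ω g 1 ∧ ∀ᶠ t in 𝓝[≥] (1 : ℝ), g t = Real.arcosh t ^ 2 := by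
  obtain ⟨g, hg, hg', hgs⟩ := exists_analyticAt_sq_eq_cosh
  have hg1 : g 0 = 1 := by simpa using hgs 0
  have hcd : ContDiffAt ℝ ω g 0 := hg.contDiffAt
  have hfd : HasFDerivAt g
      (ContinuousLinearEquiv.unitsEquivAut ℝ (Units.mk0 (1 / 2 : ℝ) (by norm_num)) : ℝ →L[ℝ] ℝ)
      0 := by
    convert! hg'.hasFDerivAt
  have hω : (ω : WithTop ℕ∞) ≠ 0 := by simp
  refine ⟨hcd.localInverse hfd hω, by simpa only [hg1] using hcd.to_localInverse hfd hω, ?_⟩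
  have hlim : Tendsto (fun t => Real.arcosh t ^ 2) (𝓝[≥] 1) (𝓝 0) := by
    simpa using (Real.continuousOn_arcosh 1 self_mem_Ici).tendsto.pow 2
  filter_upwards [hlim.eventually (hcd.hasStrictFDerivAt' hfd hω).eventually_left_inverse,
    self_mem_nhdsWithin] with t ht ht1
  rwa [hgs, Real.cosh_arcosh ht1] at ht

/-- the square of the inverse hyperbolic cosine is smooth up to the
boundary point `1`: `t ↦ (arcosh t)²` is infinitely differentiable within `[1, ∞)`
at every point of `[1, ∞)`; equivalently, there is a smooth function `F : ℝ → ℝ`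
with `F (cosh s) = s²` for all real `s` and `F t = (arcosh t)²` for all `t ≥ 1`. -/
theorem arcosh_sq_smooth_up_to_boundary :
    ContDiffOn ℝ (⊤ : ℕ∞) (fun t : ℝ => (arcosh t) ^ 2) (Set.Ici (1 : ℝ)) ∧
    ∃ F : ℝ → ℝ, ContDiff ℝ (⊤ : ℕ∞) F ∧ (∀ s : ℝ, F (Real.cosh s) = s ^ 2) ∧
      ∀ t : ℝ, 1 ≤ t → F t = (arcosh t) ^ 2 := by
  obtain ⟨g, hg, hgt⟩ := exists_contDiffAt_eventuallyEq_arcosh_sq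
  obtain ⟨F, hF, hFt⟩ := exists_contDiff_eqOn_Ici (f := fun t => Real.arcosh t ^ 2)
    (fun t ht => (Real.contDiffAt_arcosh ht).pow 2)
    ((hg.eventually (by simp)).mono fun x hx => hx.of_le (by simp)) hgt
  have harcosh : arcosh = Real.arcosh := rfl
  rw [harcosh]
  refine ⟨hF.contDiffOn.congr fun t ht => (hFt ht).symm, F, hF, fun s => ?_, fun t ht => hFt ht⟩
  rw [← Real.cosh_abs, hFt (Real.one_le_cosh _)]
  simp only [Real.arcosh_cosh (abs_nonneg s), sq_abs]
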